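/- Let N ≥ 5, τ = (N−4)/(N−2), let 0 < a < b and L₁ > L₀ > 0, and let s > 0. Then there exist constants θ > 0, C > 0 and an integer k₀ ≥ 1 such that: for every integer k ≥ k₀, every λ ∈ [L₀ k^{(N−2)/(N−4)}, L₁ k^{(N−2)/(N−4)}], every r ∈ [a,b], every ȳ″ ∈ ℝ^{N−2}, every measurable function ξ : ℝ^N → [0,1], and with W(z) = Σ_{j=1}^k ξ(z)·s·w_{x_j,λ}(z), one has for all y ∈ ℝ^N: ∫_{ℝ^N} |y−z|^{−(N−2)} W(z)^{4/(N−2)} (Σ_{j=1}^k (1+λ|z−x_j|)^{−((N−2)/2+τ)}) dz ≤ C Σ_{j=1}^k (1+λ|y−x_j|)^{−((N−2)/2+τ+θ)}. -/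

import Mathlib

open Real MeasureTheory Finset

noncomputable section

abbrev E (N : ℕ) := EuclideanSpace ℝ (Fin N)

/-- The standard bubble `w_{x,λ}(y) = (N(N-2))^{(N-2)/4} (λ/(1+λ²|y-x|²))^{(N-2)/2}`. -/
def bubble (N : ℕ) (x : E N) (l : ℝ) (y : E N) : ℝ :=
  ((N : ℝ) * ((N : ℝ) - 2)) ^ (((N : ℝ) - 2) / 4) *
    (l / (1 + l ^ 2 * ‖y - x‖ ^ 2)) ^ (((N : ℝ) - 2) / 2)

/-- The points on the regular `k`-polygon (0-indexed: `pt N k r y2 j` is `x_{j+1}`). -/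
def pt (N k : ℕ) (r : ℝ) (y2 : E (N - 2)) (j : ℕ) : E N :=
  (EuclideanSpace.equiv (Fin N) ℝ).symm fun i =>
    if h0 : (i : ℕ) = 0 then r * Real.cos (2 * Real.pi * j / k)
    else if h1 : (i : ℕ) = 1 then r * Real.sin (2 * Real.pi * j / k)
    else y2 ⟨(i : ℕ) - 2, by have := i.2; omega⟩

/-- `τ = (N-4)/(N-2)`. -/
def tau (N : ℕ) : ℝ := ((N : ℝ) - 4) / ((N : ℝ) - 2)

lemma rpow_neg_le_mul_rpow_neg {x y c p : ℝ} (hx : 0 < x) (hy : 0 < y) (hc : 0 < c) (hp : 0 ≤ p)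
    (h : x ≤ c * y) : y ^ (-p) ≤ c ^ p * x ^ (-p) := by
  have h1 : x ^ p ≤ c ^ p * y ^ p := by
    rw [← Real.mul_rpow hc.le hy.le]
    exact Real.rpow_le_rpow hx.le h hp
  rw [Real.rpow_neg hy.le, Real.rpow_neg hx.le, ← div_eq_mul_inv, le_div_iff₀ (by positivity),
    inv_mul_le_iff₀ (by positivity)]
  linarith

lemma sum_Icc_rpow_neg_le {t : ℝ} (ht0 : 0 ≤ t) (ht1 : t < 1) (k : ℕ) :
    ∑ m ∈ Finset.Icc 1 k, (m : ℝ) ^ (-t) ≤ (k : ℝ) ^ (1 - t) / (1 - t) := by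
  have h1t : 0 < 1 - t := by linarith
  induction k with
  | zero => simp [Real.zero_rpow h1t.ne']
  | succ k ih =>
    rw [Finset.sum_Icc_succ_top (by omega)]
    have hk : (0 : ℝ) < (k : ℝ) + 1 := by positivity
    have hb := rpow_one_add_le_one_add_mul_self (s := -(1 / ((k : ℝ) + 1))) (p := 1 - t)
      (by rw [neg_le_neg_iff, div_le_one hk]; linarith [(Nat.cast_nonneg k : (0 : ℝ) ≤ k)])
      h1t.le (by linarith)
    have e1 : 1 + -(1 / ((k : ℝ) + 1)) = k / (k + 1) := by field_simp; ring
    rw [e1, Real.div_rpow (Nat.cast_nonneg k) hk.le, div_le_iff₀ (by positivity)] at hb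
    have e2 : ((k : ℝ) + 1) ^ (-t) = ((k : ℝ) + 1) ^ (1 - t) / (k + 1) := by
      rw [← Real.rpow_sub_one hk.ne']; congr 1; ring
    push_cast
    rw [e2]
    rw [le_div_iff₀ h1t] at ih ⊢
    have e3 : (1 + (1 - t) * -(1 / ((k : ℝ) + 1))) * ((k : ℝ) + 1) ^ (1 - t)
      = ((k : ℝ) + 1) ^ (1 - t) - ((k : ℝ) + 1) ^ (1 - t) / (k + 1) * (1 - t) := by ring
    rw [add_mul]
    linarith

lemma sum_comp_le_sum_Icc {F : ℕ → ℝ} (hF : ∀ m, 0 ≤ F m) {k : ℕ} {s : Finset ℕ} {g : ℕ → ℕ}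
    (hg : Set.InjOn g s) (hs : ∀ j ∈ s, g j ∈ Finset.Icc 1 k) :
    ∑ j ∈ s, F (g j) ≤ ∑ m ∈ Finset.Icc 1 k, F m := by
  rw [← Finset.sum_image (f := F) hg]
  exact Finset.sum_le_sum_of_subset_of_nonneg (Finset.image_subset_iff.2 hs) fun _ _ _ => hF _

lemma norm_pt_sub_pt_ge {N k : ℕ} (hN : 2 ≤ N) (r : ℝ) (y2 : E (N - 2)) (i j : ℕ) :
    2 * r * |Real.sin (π * ((j : ℝ) - i) / k)| ≤ ‖pt N k r y2 i - pt N k r y2 j‖ := by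
  refine le_of_sq_le_sq ?_ (norm_nonneg _)
  rw [EuclideanSpace.norm_sq_eq]
  have h01 : (⟨0, by omega⟩ : Fin N) ≠ ⟨1, by omega⟩ := by simp
  have hsub := Finset.sum_le_sum_of_subset_of_nonneg
    (Finset.subset_univ ({⟨0, by omega⟩, ⟨1, by omega⟩} : Finset (Fin N)))
    (f := fun m => ‖(pt N k r y2 i - pt N k r y2 j) m‖ ^ 2) (fun _ _ _ => by positivity)
  rw [Finset.sum_pair h01] at hsub
  refine le_trans (le_of_eq ?_) hsub
  simp only [pt, PiLp.sub_apply, Real.norm_eq_abs, sq_abs, mul_pow]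
  simp
  have e : π * ((j : ℝ) - i) / k = (2 * π * j / k - 2 * π * i / k) / 2 := by ring
  have h2 := Real.sin_sq_eq_half_sub ((2 * π * j / k - 2 * π * i / k) / 2)
  rw [e, h2, mul_div_cancel₀ _ (two_ne_zero), Real.cos_sub]
  have p1 := Real.sin_sq_add_cos_sq (2 * π * j / k)
  have p2 := Real.sin_sq_add_cos_sq (2 * π * i / k)
  linear_combination (-r^2) * p1 - r^2 * p2

lemma two_mul_min_div_le_abs_sin {k m : ℕ} (hk : 0 < k) (hm : m ≤ k) :
    2 * (min m (k - m) : ℕ) / (k : ℝ) ≤ |Real.sin (π * m / k)| := by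
  have key : ∀ n : ℕ, 2 * n ≤ k → 2 * (n : ℝ) / k ≤ Real.sin (π * n / k) := by
    intro n hn
    have hk' : (0 : ℝ) < k := by exact_mod_cast hk
    have hn' : 2 * (n : ℝ) ≤ k := by exact_mod_cast hn
    have := Real.mul_le_sin (x := π * n / k) (by positivity) (by
      rw [div_le_div_iff₀ hk' two_pos]; nlinarith [Real.pi_pos])
    refine le_trans (le_of_eq ?_) this
    field_simp
  rcases le_total (2 * m) k with h | h
  · rw [min_eq_left (by omega)]
    exact (key m h).trans (le_abs_self _)
  · rw [min_eq_right (by omega)]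
    have hk' : (k : ℝ) ≠ 0 := by positivity
    have e : π * m / k = π - π * (k - m : ℕ) / k := by
      rw [Nat.cast_sub hm]; field_simp; ring
    rw [e, Real.sin_pi_sub]
    exact (key (k - m) (by omega)).trans (le_abs_self _)

/-- Distinct vertices at index distance `m` are at distance at least `4 r min(m, k - m) / k`. -/
lemma four_mul_min_div_le_norm_pt_sub_pt {N k : ℕ} (hN : 2 ≤ N) {r : ℝ} (hr : 0 ≤ r)
    (y2 : E (N - 2)) {i j : ℕ} (hij : i < j) (hj : j < k) :
    4 * r * (min (j - i) (k - (j - i)) : ℕ) / k ≤ ‖pt N k r y2 i - pt N k r y2 j‖ := by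
  have h1 := norm_pt_sub_pt_ge (k := k) hN r y2 i j
  have h2 := two_mul_min_div_le_abs_sin (k := k) (m := j - i) (by omega) (by omega)
  rw [Nat.cast_sub hij.le] at h2
  calc _ = 2 * r * (2 * (min (j - i) (k - (j - i)) : ℕ) / k) := by ring
    _ ≤ _ := (mul_le_mul_of_nonneg_left h2 (by positivity)).trans h1

lemma min_rpow_neg_le_add {t : ℝ} (m n : ℕ) :
    ((min m n : ℕ) : ℝ) ^ (-t) ≤ (m : ℝ) ^ (-t) + (n : ℝ) ^ (-t) := by
  have hm : 0 ≤ (m : ℝ) ^ (-t) := by positivity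
  have hn : 0 ≤ (n : ℝ) ^ (-t) := by positivity
  rcases min_choice m n with h | h <;> rw [h] <;> linarith

/-- The weights `(1 + l |z - x_j|)^{-t}` have uniformly bounded sum when `k ≲ l ^ t`. -/
lemma sum_one_add_rpow_neg_le {N k : ℕ} (hN : 2 ≤ N) {a r c t l : ℝ} (ha : 0 < a) (har : a ≤ r)
    (ht0 : 0 < t) (ht1 : t < 1) (hc : 0 < c) (hl : 0 < l) (hlk : c * k ≤ l ^ t)
    (y2 : E (N - 2)) (z : E N) {i : ℕ} (hi : i < k)
    (hmin : ∀ j < k, ‖z - pt N k r y2 i‖ ≤ ‖z - pt N k r y2 j‖) :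
    ∑ j ∈ Finset.range k, (1 + l * ‖z - pt N k r y2 j‖) ^ (-t) ≤
      1 + 4 * ((2 * a) ^ (-t) / (c * (1 - t))) := by
  have hk : (0 : ℝ) < k := by exact_mod_cast (by omega : 0 < k)
  set A : ℝ := (2 * a) ^ (-t) / c * (k : ℝ) ^ (t - 1) with hA
  have hA0 : 0 ≤ A := by positivity
  have hr : 0 < r := ha.trans_le har
  have far : ∀ j < k, ∀ m : ℕ, 0 < m → m < k →
      4 * r * (min m (k - m) : ℕ) / k ≤ ‖pt N k r y2 i - pt N k r y2 j‖ →
      (1 + l * ‖z - pt N k r y2 j‖) ^ (-t) ≤ A * ((m : ℝ) ^ (-t) + ((k - m : ℕ) : ℝ) ^ (-t)) := by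
    intro j hj m hm hmk hd
    have htri : ‖pt N k r y2 i - pt N k r y2 j‖ ≤ ‖z - pt N k r y2 i‖ + ‖z - pt N k r y2 j‖ := by
      rw [← norm_neg (z - pt N k r y2 i)]
      refine le_trans (le_of_eq ?_) (norm_add_le _ _)
      congr 1; abel
    have hM : (0 : ℝ) < (min m (k - m) : ℕ) := by
      exact_mod_cast (by omega : 0 < min m (k - m))
    set M : ℝ := ((min m (k - m) : ℕ) : ℝ) with hMdef
    have hdist : 2 * a * M / k ≤ ‖z - pt N k r y2 j‖ := by
      have h1 := hmin j hj
      have h2 : 4 * a * M / k ≤ 4 * r * M / k := by gcongr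
      have h3 : 4 * a * M / k = 2 * (2 * a * M / k) := by ring
      linarith
    have hbase : l * (2 * a * M / k) ≤ 1 + l * ‖z - pt N k r y2 j‖ := by
      have := mul_le_mul_of_nonneg_left hdist hl.le
      linarith
    have hlt : l ^ (-t) ≤ c⁻¹ * (k : ℝ)⁻¹ := by
      rw [Real.rpow_neg hl.le, ← mul_inv]
      exact inv_anti₀ (by positivity) hlk
    calc (1 + l * ‖z - pt N k r y2 j‖) ^ (-t)
        ≤ (l * (2 * a * M / k)) ^ (-t) :=
          Real.rpow_le_rpow_of_nonpos (by positivity) hbase (by linarith)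
      _ = l ^ (-t) * ((2 * a) ^ (-t) * M ^ (-t) * (k : ℝ) ^ t) := by
          rw [Real.mul_rpow hl.le (by positivity), Real.div_rpow (by positivity) hk.le,
            Real.mul_rpow (by positivity) hM.le, Real.rpow_neg hk.le, div_inv_eq_mul]
      _ ≤ c⁻¹ * (k : ℝ)⁻¹ * ((2 * a) ^ (-t) * M ^ (-t) * (k : ℝ) ^ t) := by gcongr
      _ = A * M ^ (-t) := by
          rw [hA, Real.rpow_sub_one hk.ne']; ring
      _ ≤ _ := mul_le_mul_of_nonneg_left (min_rpow_neg_le_add _ _) hA0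
  have hS := sum_Icc_rpow_neg_le ht0.le ht1 k
  set S := ∑ m ∈ Finset.Icc 1 k, (m : ℝ) ^ (-t) with hSdef
  have hF : ∀ m : ℕ, 0 ≤ (m : ℝ) ^ (-t) := fun m => by positivity
  have hleft : ∑ j ∈ Finset.range i, (1 + l * ‖z - pt N k r y2 j‖) ^ (-t) ≤ A * (S + S) := by
    calc _ ≤ ∑ j ∈ Finset.range i,
          A * (((i - j : ℕ) : ℝ) ^ (-t) + ((k - (i - j) : ℕ) : ℝ) ^ (-t)) := by
          refine Finset.sum_le_sum fun j hj => ?_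
          rw [Finset.mem_range] at hj
          refine far j (by omega) (i - j) (by omega) (by omega) ?_
          rw [norm_sub_rev]
          exact four_mul_min_div_le_norm_pt_sub_pt hN hr.le y2 hj hi
      _ ≤ _ := by
          rw [← Finset.mul_sum, Finset.sum_add_distrib]
          refine mul_le_mul_of_nonneg_left (add_le_add ?_ ?_) hA0
          · refine sum_comp_le_sum_Icc hF (g := fun j => i - j) ?_ ?_
            · intro x hx y hy h; simp at hx hy h; omega
            · intro x hx; simp at hx ⊢; omega
          · refine sum_comp_le_sum_Icc hF (g := fun j => k - (i - j)) ?_ ?_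
            · intro x hx y hy h; simp at hx hy h; omega
            · intro x hx; simp at hx ⊢; omega
  have hright : ∑ j ∈ Finset.Ico (i + 1) k, (1 + l * ‖z - pt N k r y2 j‖) ^ (-t) ≤ A * (S + S) := by
    calc _ ≤ ∑ j ∈ Finset.Ico (i + 1) k,
          A * (((j - i : ℕ) : ℝ) ^ (-t) + ((k - (j - i) : ℕ) : ℝ) ^ (-t)) := by
          refine Finset.sum_le_sum fun j hj => ?_
          rw [Finset.mem_Ico] at hj
          exact far j (by omega) (j - i) (by omega) (by omega)
            (four_mul_min_div_le_norm_pt_sub_pt hN hr.le y2 (by omega) (by omega))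
      _ ≤ _ := by
          rw [← Finset.mul_sum, Finset.sum_add_distrib]
          refine mul_le_mul_of_nonneg_left (add_le_add ?_ ?_) hA0
          · refine sum_comp_le_sum_Icc hF (g := fun j => j - i) ?_ ?_
            · intro x hx y hy h; simp at hx hy h; omega
            · intro x hx; simp at hx ⊢; omega
          · refine sum_comp_le_sum_Icc hF (g := fun j => k - (j - i)) ?_ ?_
            · intro x hx y hy h; simp at hx hy h; omega
            · intro x hx; simp at hx ⊢; omega
  have hself : (1 + l * ‖z - pt N k r y2 i‖) ^ (-t) ≤ 1 :=
    Real.rpow_le_one_of_one_le_of_nonpos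
      (by linarith [mul_nonneg hl.le (norm_nonneg (z - pt N k r y2 i))]) (by linarith)
  have hAS : A * S ≤ (2 * a) ^ (-t) / (c * (1 - t)) := by
    calc A * S ≤ A * ((k : ℝ) ^ (1 - t) / (1 - t)) := mul_le_mul_of_nonneg_left hS hA0
      _ = (2 * a) ^ (-t) / (c * (1 - t)) * ((k : ℝ) ^ (t - 1) * (k : ℝ) ^ (1 - t)) := by
          rw [hA]; field_simp
      _ = _ := by rw [← Real.rpow_add hk]; simp
  rw [← Finset.sum_range_add_sum_Ico _ hi.le, Finset.sum_eq_sum_Ico_succ_bot hi]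
  linarith

/-- Pointwise splitting of `v^{-D} (1 + w)^{-(2 + β + ε)}` for side lengths `d, v, w` of a
triangle. -/
lemma kernel_mul_weight_le {D β ε d v w : ℝ} (hβ : 0 ≤ β) (hβD : β ≤ D) (hε : 0 < ε)
    (hd : 0 ≤ d) (hv : 0 ≤ v) (hw : 0 ≤ w) (h1 : d ≤ w + v) (h2 : w ≤ d + v) :
    v ^ (-D) * (1 + w) ^ (-(2 + β + ε)) ≤
      (2 ^ β * 4 ^ (2 + ε) + 2 ^ β * 3 ^ (D - β)) * (1 + d) ^ (-β) *
        (v ^ (-D) * (1 + v) ^ (-(2 + ε)) + (1 + w) ^ (-(D + 2 + ε))) := by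
  have hw1 : 0 < 1 + w := by linarith
  have hd1 : 0 < 1 + d := by linarith
  have hv1 : 0 < 1 + v := by linarith
  have hP : 0 ≤ v ^ (-D) * (1 + v) ^ (-(2 + ε)) := by positivity
  have hQ : 0 ≤ (1 + w) ^ (-(D + 2 + ε)) := by positivity
  rcases le_or_gt v ((1 + d) / 2) with h | h
  · have b1 : (1 + w) ^ (-β) ≤ 2 ^ β * (1 + d) ^ (-β) :=
      rpow_neg_le_mul_rpow_neg hd1 hw1 two_pos hβ (by linarith)
    have b2 : (1 + w) ^ (-(2 + ε)) ≤ 4 ^ (2 + ε) * (1 + v) ^ (-(2 + ε)) :=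
      rpow_neg_le_mul_rpow_neg hv1 hw1 (by norm_num) (by linarith) (by linarith)
    calc v ^ (-D) * (1 + w) ^ (-(2 + β + ε))
        = v ^ (-D) * ((1 + w) ^ (-β) * (1 + w) ^ (-(2 + ε))) := by
          rw [← Real.rpow_add hw1]; congr 2; ring
      _ ≤ v ^ (-D) * ((2 ^ β * (1 + d) ^ (-β)) * (4 ^ (2 + ε) * (1 + v) ^ (-(2 + ε)))) := by
          gcongr
      _ = (2 ^ β * 4 ^ (2 + ε)) * (1 + d) ^ (-β) * (v ^ (-D) * (1 + v) ^ (-(2 + ε))) := by ring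
      _ ≤ _ := by
          gcongr
          · exact le_add_of_nonneg_right (by positivity)
          · exact le_add_of_nonneg_right hQ
  · have hv0 : 0 < v := by linarith
    have b1 : v ^ (-β) ≤ 2 ^ β * (1 + d) ^ (-β) :=
      rpow_neg_le_mul_rpow_neg hd1 hv0 two_pos hβ (by linarith)
    have b2 : v ^ (-(D - β)) ≤ 3 ^ (D - β) * (1 + w) ^ (-(D - β)) :=
      rpow_neg_le_mul_rpow_neg hw1 hv0 (by norm_num) (by linarith) (by linarith)
    calc v ^ (-D) * (1 + w) ^ (-(2 + β + ε))
        = v ^ (-β) * v ^ (-(D - β)) * (1 + w) ^ (-(2 + β + ε)) := by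
          rw [← Real.rpow_add hv0]; congr 2; ring
      _ ≤ (2 ^ β * (1 + d) ^ (-β)) * (3 ^ (D - β) * (1 + w) ^ (-(D - β))) *
            (1 + w) ^ (-(2 + β + ε)) := by gcongr
      _ = (2 ^ β * 3 ^ (D - β)) * (1 + d) ^ (-β) *
            ((1 + w) ^ (-(D - β)) * (1 + w) ^ (-(2 + β + ε))) := by ring
      _ = (2 ^ β * 3 ^ (D - β)) * (1 + d) ^ (-β) * (1 + w) ^ (-(D + 2 + ε)) := by
          rw [← Real.rpow_add hw1]; congr 2; ring
      _ ≤ _ := by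
          gcongr
          · exact le_add_of_nonneg_left (by positivity)
          · exact le_add_of_nonneg_left hP

lemma integrable_norm_rpow_mul_one_add_norm_rpow {N : ℕ} (hN : 2 ≤ N) {ε : ℝ} (hε : 0 < ε) :
    Integrable fun v : E N => ‖v‖ ^ (-((N : ℝ) - 2)) * (1 + ‖v‖) ^ (-(2 + ε)) := by
  have : Nontrivial (E N) := by
    have : Nonempty (Fin N) := ⟨⟨0, by omega⟩⟩
    infer_instance
  rw [integrable_fun_norm_addHaar volume
    (f := fun t : ℝ => t ^ (-((N : ℝ) - 2)) * (1 + t) ^ (-(2 + ε)))]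
  have hint : IntegrableOn (fun t : ℝ => (t + 1) ^ (-(1 + ε))) (Set.Ioi 0) :=
    integrableOn_add_rpow_Ioi_of_lt (by linarith) (by norm_num)
  refine Integrable.mono' hint (Measurable.aestronglyMeasurable (by fun_prop)) ?_
  filter_upwards [ae_restrict_mem measurableSet_Ioi] with t ht
  have ht : 0 < t := ht
  rw [Real.norm_of_nonneg (by simp only [smul_eq_mul]; positivity), finrank_euclideanSpace_fin,
    smul_eq_mul, ← mul_assoc, ← Real.rpow_natCast, ← Real.rpow_add ht,
    Nat.cast_sub (by omega : 1 ≤ N)]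
  have e : (N : ℝ) - (1 : ℕ) + -((N : ℝ) - 2) = 1 := by push_cast; ring
  rw [e, Real.rpow_one]
  calc t * (1 + t) ^ (-(2 + ε)) ≤ (1 + t) * (1 + t) ^ (-(2 + ε)) := by gcongr; linarith
    _ = (t + 1) ^ (-(1 + ε)) := by
      rw [← Real.rpow_one_add' (by positivity) (by linarith), add_comm t 1]; congr 1; ring

lemma integral_comp_smul_sub {N : ℕ} (f : E N → ℝ) {l : ℝ} (hl : 0 < l) (x : E N) :
    ∫ z, f (l • (z - x)) = (l ^ N)⁻¹ * ∫ z, f z := by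
  rw [integral_sub_right_eq_self (fun z => f (l • z)) x, Measure.integral_comp_smul,
    finrank_euclideanSpace_fin, abs_of_pos (by positivity), smul_eq_mul]

/-- Convolution of the Newtonian kernel with a rescaled weight loses two powers. -/
lemma newtonian_convolution_weight_le {N : ℕ} (hN : 2 ≤ N) {β ε : ℝ} (hβ : 0 ≤ β)
    (hβN : β ≤ (N : ℝ) - 2) (hε : 0 < ε) :
    ∃ C : ℝ, 0 < C ∧ ∀ l : ℝ, 0 < l → ∀ x y : E N,
      Integrable (fun z : E N =>
        ‖y - z‖ ^ (-((N : ℝ) - 2)) * (l ^ 2 * (1 + l * ‖z - x‖) ^ (-(2 + β + ε)))) ∧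
      ∫ z : E N, ‖y - z‖ ^ (-((N : ℝ) - 2)) * (l ^ 2 * (1 + l * ‖z - x‖) ^ (-(2 + β + ε))) ≤
        C * (1 + l * ‖y - x‖) ^ (-β) := by
  set D : ℝ := (N : ℝ) - 2 with hD
  set K : ℝ := 2 ^ β * 4 ^ (2 + ε) + 2 ^ β * 3 ^ (D - β) with hK
  set g : E N → ℝ := fun v => ‖v‖ ^ (-D) * (1 + ‖v‖) ^ (-(2 + ε)) with hg
  set h : E N → ℝ := fun w => (1 + ‖w‖) ^ (-(D + 2 + ε)) with hh
  have hgi : Integrable g := integrable_norm_rpow_mul_one_add_norm_rpow hN hε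
  have hhi : Integrable h := integrable_one_add_norm (by
    rw [finrank_euclideanSpace_fin]; linarith)
  have hg0 : 0 ≤ ∫ v, g v := integral_nonneg fun v => by positivity
  have hh0 : 0 ≤ ∫ v, h v := integral_nonneg fun v => by positivity
  have hK0 : 0 < K := by positivity
  refine ⟨K * ((∫ v, g v) + ∫ v, h v) + 1, by positivity, fun l hl x y => ?_⟩
  set B : ℝ := l ^ N * (K * (1 + l * ‖y - x‖) ^ (-β)) with hB
  have hpt : ∀ z, ‖y - z‖ ^ (-D) * (l ^ 2 * (1 + l * ‖z - x‖) ^ (-(2 + β + ε))) ≤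
      B * (g (l • (z - y)) + h (l • (z - x))) := by
    intro z
    have t1 : ‖y - x‖ ≤ ‖z - x‖ + ‖y - z‖ := by
      rw [add_comm]; exact norm_sub_le_norm_sub_add_norm_sub y z x
    have t2 : ‖z - x‖ ≤ ‖y - x‖ + ‖y - z‖ := by
      rw [add_comm, norm_sub_rev y z]; exact norm_sub_le_norm_sub_add_norm_sub z y x
    have key := kernel_mul_weight_le (D := D) (d := l * ‖y - x‖) (v := l * ‖y - z‖)
      (w := l * ‖z - x‖) hβ hβN hε (by positivity) (by positivity) (by positivity)
      (by rw [← mul_add]; gcongr) (by rw [← mul_add]; gcongr)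
    have e1 : ‖y - z‖ ^ (-D) * l ^ 2 = l ^ N * (l * ‖y - z‖) ^ (-D) := by
      have : l ^ N * l ^ (-D) = l ^ 2 := by
        rw [← Real.rpow_natCast l N, ← Real.rpow_add hl, ← Real.rpow_natCast l 2]
        congr 1; rw [hD]; push_cast; ring
      rw [Real.mul_rpow hl.le (norm_nonneg _), ← mul_assoc, this]; ring
    have e2 : g (l • (z - y)) = (l * ‖y - z‖) ^ (-D) * (1 + l * ‖y - z‖) ^ (-(2 + ε)) := by
      simp only [hg, norm_smul, Real.norm_of_nonneg hl.le, norm_sub_rev z y]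
    have e3 : h (l • (z - x)) = (1 + l * ‖z - x‖) ^ (-(D + 2 + ε)) := by
      simp only [hh, norm_smul, Real.norm_of_nonneg hl.le]
    rw [← mul_assoc, e1, e2, e3, mul_assoc, hB, mul_assoc (l ^ N)]
    exact mul_le_mul_of_nonneg_left key (by positivity)
  have i1 : Integrable fun z => g (l • (z - y)) := (hgi.comp_smul hl.ne').comp_sub_right y
  have i2 : Integrable fun z => h (l • (z - x)) := (hhi.comp_smul hl.ne').comp_sub_right x
  have ib := (i1.add i2).const_mul B
  have hf0 : ∀ z, 0 ≤ ‖y - z‖ ^ (-D) * (l ^ 2 * (1 + l * ‖z - x‖) ^ (-(2 + β + ε))) :=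
    fun z => by positivity
  have hfi : Integrable fun z : E N =>
      ‖y - z‖ ^ (-D) * (l ^ 2 * (1 + l * ‖z - x‖) ^ (-(2 + β + ε))) := by
    refine Integrable.mono' ib (Measurable.aestronglyMeasurable (by fun_prop))
      (Filter.Eventually.of_forall fun z => ?_)
    rw [Real.norm_of_nonneg (hf0 z)]
    exact hpt z
  refine ⟨hfi, (integral_mono hfi ib hpt).trans ?_⟩
  have hw : 0 ≤ (1 + l * ‖y - x‖) ^ (-β) := by positivity
  calc ∫ z, B * (g (l • (z - y)) + h (l • (z - x)))
      = B * ((l ^ N)⁻¹ * (∫ v, g v) + (l ^ N)⁻¹ * ∫ v, h v) := by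
        rw [integral_const_mul, integral_add i1 i2, integral_comp_smul_sub g hl,
          integral_comp_smul_sub h hl]
    _ = K * ((∫ v, g v) + ∫ v, h v) * (1 + l * ‖y - x‖) ^ (-β) := by
        rw [hB]; field_simp
    _ ≤ _ := by gcongr; linarith

lemma bubble_nonneg {N : ℕ} (hN : 2 ≤ N) (x : E N) {l : ℝ} (hl : 0 ≤ l) (z : E N) :
    0 ≤ bubble N x l z := by
  have : (0 : ℝ) ≤ (N : ℝ) - 2 := by
    have : (2 : ℝ) ≤ N := by exact_mod_cast hN
    linarith
  unfold bubble
  positivity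

lemma bubble_le {N : ℕ} (hN : 2 ≤ N) (x : E N) {l : ℝ} (hl : 0 < l) (z : E N) :
    bubble N x l z ≤ ((N : ℝ) * ((N : ℝ) - 2)) ^ (((N : ℝ) - 2) / 4) *
      (2 * l) ^ (((N : ℝ) - 2) / 2) * (1 + l * ‖z - x‖) ^ (-((N : ℝ) - 2)) := by
  have hD : (0 : ℝ) ≤ (N : ℝ) - 2 := by
    have : (2 : ℝ) ≤ N := by exact_mod_cast hN
    linarith
  unfold bubble
  rw [mul_assoc]
  gcongr
  set t := l * ‖z - x‖ with ht
  have ht0 : 0 ≤ t := by positivity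
  have e : l ^ 2 * ‖z - x‖ ^ 2 = t ^ 2 := by rw [ht]; ring
  have h1 : l / (1 + t ^ 2) ≤ 2 * l / (1 + t) ^ 2 := by
    rw [div_le_div_iff₀ (by positivity) (by positivity)]
    nlinarith [mul_nonneg hl.le (sq_nonneg (t - 1))]
  rw [e]
  calc (l / (1 + t ^ 2)) ^ (((N : ℝ) - 2) / 2)
      ≤ (2 * l / (1 + t) ^ 2) ^ (((N : ℝ) - 2) / 2) := by gcongr
    _ = _ := by
      rw [Real.div_rpow (by positivity) (by positivity), ← Real.rpow_natCast (1 + t) 2,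
        ← Real.rpow_mul (by positivity), Real.rpow_neg (by positivity), div_eq_mul_inv]
      congr 3; push_cast; ring

lemma sum_rpow_neg_le_of_forall_ge {ι : Type*} {s : Finset ι} {T : ι → ℝ} {T₀ t α M : ℝ}
    (hT₀ : 0 < T₀) (hT : ∀ j ∈ s, T₀ ≤ T j) (hα : t ≤ α) (hM : ∑ j ∈ s, T j ^ (-t) ≤ M) :
    ∑ j ∈ s, T j ^ (-α) ≤ M * T₀ ^ (-(α - t)) := by
  refine le_trans ?_ (mul_le_mul_of_nonneg_right hM (by positivity))
  rw [Finset.sum_mul]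
  refine Finset.sum_le_sum fun j hj => ?_
  have hTj := hT₀.trans_le (hT j hj)
  have e : -α = -t + -(α - t) := by ring
  rw [e, Real.rpow_add hTj]
  exact mul_le_mul_of_nonneg_left
    (Real.rpow_le_rpow_of_nonpos hT₀ (hT j hj) (by linarith)) (by positivity)

lemma tau_pos {N : ℕ} (hN : 5 ≤ N) : 0 < tau N := by
  have : (5 : ℝ) ≤ N := by exact_mod_cast hN
  exact div_pos (by linarith) (by linarith)

lemma tau_lt_one {N : ℕ} (hN : 5 ≤ N) : tau N < 1 := by
  have : (5 : ℝ) ≤ N := by exact_mod_cast hN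
  exact (div_lt_one (by linarith)).2 (by linarith)

lemma weight_exponent_le {N : ℕ} (hN : 5 ≤ N) :
    2 + (((N : ℝ) - 2) / 2 + tau N + 1 / 4) + 1 / 4 ≤
      ((N : ℝ) - 2 - tau N) * (4 / ((N : ℝ) - 2)) + ((N : ℝ) - 2) / 2 := by
  have h5 : (5 : ℝ) ≤ N := by exact_mod_cast hN
  obtain ⟨D, hD⟩ : ∃ D : ℝ, D = (N : ℝ) - 2 := ⟨_, rfl⟩
  have hD3 : 3 ≤ D := by linarith
  have hD0 : D ≠ 0 := by positivity
  have hN4 : (N : ℝ) - 4 = D - 2 := by linarith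
  unfold tau
  rw [hN4, ← hD, ← sub_nonneg]
  have e : (D - (D - 2) / D) * (4 / D) + D / 2 - (2 + (D / 2 + (D - 2) / D + 1 / 4) + 1 / 4) =
      (D ^ 2 - 4 * D + 16) / (2 * D ^ 2) := by
    field_simp; ring
  rw [e]
  exact div_nonneg (by nlinarith [sq_nonneg (D - 2)]) (by positivity)

/-- At a point nearest to the vertex `x_i`, the nonlinear potential times the weight is controlled
by a single weight centred at `x_i`. -/
lemma potential_mul_weight_le {N : ℕ} (hN : 5 ≤ N) {k i : ℕ} {l s M : ℝ} (hl : 0 < l)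
    (hs : 0 < s) (x : ℕ → E N) {ξ z} (hξ : ξ ∈ Set.Icc (0 : ℝ) 1)
    (hmin : ∀ j ∈ Finset.range k, ‖z - x i‖ ≤ ‖z - x j‖) (hM0 : 0 ≤ M)
    (hM : ∑ j ∈ Finset.range k, (1 + l * ‖z - x j‖) ^ (-tau N) ≤ M) :
    (∑ j ∈ Finset.range k, ξ * (s * bubble N (x j) l z)) ^ (4 / ((N : ℝ) - 2)) *
        ∑ j ∈ Finset.range k, (1 + l * ‖z - x j‖) ^ (-(((N : ℝ) - 2) / 2 + tau N)) ≤
      ((s * ((N : ℝ) * ((N : ℝ) - 2)) ^ (((N : ℝ) - 2) / 4) * M) ^ (4 / ((N : ℝ) - 2)) * 4 * M) *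
        (l ^ 2 * (1 + l * ‖z - x i‖) ^ (-(2 + (((N : ℝ) - 2) / 2 + tau N + 1 / 4) + 1 / 4))) := by
  have h5 : (5 : ℝ) ≤ N := by exact_mod_cast hN
  have hexp := weight_exponent_le hN
  have ht1 := tau_lt_one hN
  set D : ℝ := (N : ℝ) - 2 with hD
  set K : ℝ := ((N : ℝ) * D) ^ (D / 4) with hK
  set T : ℝ := 1 + l * ‖z - x i‖ with hT
  have hD3 : 3 ≤ D := by linarith
  have hT1 : 1 ≤ T := by
    have : 0 ≤ l * ‖z - x i‖ := by positivity
    linarith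
  have hT0 : 0 < T := by linarith
  have hge : ∀ j ∈ Finset.range k, T ≤ 1 + l * ‖z - x j‖ := fun j hj => by
    have := mul_le_mul_of_nonneg_left (hmin j hj) hl.le
    linarith
  have hw := sum_rpow_neg_le_of_forall_ge hT0 hge (α := D / 2 + tau N) (by linarith) hM
  have hV := sum_rpow_neg_le_of_forall_ge hT0 hge (α := D) (by linarith) hM
  rw [add_sub_cancel_right] at hw
  have hb0 : ∀ j, 0 ≤ bubble N (x j) l z := fun j => bubble_nonneg (by omega) _ hl.le _
  have hpot : ∑ j ∈ Finset.range k, ξ * (s * bubble N (x j) l z) ≤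
      (s * K * M) * (2 * l) ^ (D / 2) * T ^ (-(D - tau N)) := by
    calc _ ≤ ∑ j ∈ Finset.range k,
          s * K * (2 * l) ^ (D / 2) * (1 + l * ‖z - x j‖) ^ (-D) := by
          refine Finset.sum_le_sum fun j _ => ?_
          calc ξ * (s * bubble N (x j) l z) ≤ 1 * (s * bubble N (x j) l z) :=
                mul_le_mul_of_nonneg_right hξ.2 (mul_nonneg hs.le (hb0 j))
            _ ≤ s * (K * (2 * l) ^ (D / 2) * (1 + l * ‖z - x j‖) ^ (-D)) := by
                rw [one_mul]
                exact mul_le_mul_of_nonneg_left (bubble_le (by omega) _ hl _) hs.le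
            _ = _ := by ring
      _ ≤ s * K * (2 * l) ^ (D / 2) * (M * T ^ (-(D - tau N))) := by
          rw [← Finset.mul_sum]; gcongr
      _ = _ := by ring
  have hpot0 : 0 ≤ ∑ j ∈ Finset.range k, ξ * (s * bubble N (x j) l z) :=
    Finset.sum_nonneg fun j _ => mul_nonneg hξ.1 (mul_nonneg hs.le (hb0 j))
  have hpow : (∑ j ∈ Finset.range k, ξ * (s * bubble N (x j) l z)) ^ (4 / D) ≤
      (s * K * M) ^ (4 / D) * (4 * l ^ 2) * T ^ (-((D - tau N) * (4 / D))) := by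
    refine (Real.rpow_le_rpow hpot0 hpot (by positivity)).trans (le_of_eq ?_)
    rw [Real.mul_rpow (by positivity) (by positivity), Real.mul_rpow (by positivity)
      (by positivity), ← Real.rpow_mul (by positivity), ← Real.rpow_mul hT0.le]
    have e : D / 2 * (4 / D) = (2 : ℕ) := by push_cast; field_simp; norm_num
    rw [e, Real.rpow_natCast, neg_mul]; ring
  calc _ ≤ ((s * K * M) ^ (4 / D) * (4 * l ^ 2) * T ^ (-((D - tau N) * (4 / D)))) *
        (M * T ^ (-(D / 2))) := by gcongr
    _ = ((s * K * M) ^ (4 / D) * 4 * M) *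
        (l ^ 2 * (T ^ (-((D - tau N) * (4 / D))) * T ^ (-(D / 2)))) := by ring
    _ ≤ _ := by
      rw [← Real.rpow_add hT0]
      gcongr
      linarith

lemma mul_natCast_le_rpow_tau {N : ℕ} (hN : 5 ≤ N) {L0 l : ℝ} (hL0 : 0 < L0) (k : ℕ)
    (hl : L0 * (k : ℝ) ^ (((N : ℝ) - 2) / ((N : ℝ) - 4)) ≤ l) :
    L0 ^ tau N * k ≤ l ^ tau N := by
  have h5 : (5 : ℝ) ≤ N := by exact_mod_cast hN
  have h := Real.rpow_le_rpow (by positivity) hl (tau_pos hN).le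
  rw [Real.mul_rpow hL0.le (by positivity), ← Real.rpow_mul (by positivity)] at h
  have e : ((N : ℝ) - 2) / ((N : ℝ) - 4) * tau N = 1 := by
    unfold tau
    have h2 : (N : ℝ) - 2 ≠ 0 := by linarith
    have h4 : (N : ℝ) - 4 ≠ 0 := by linarith
    field_simp
  rwa [e, Real.rpow_one] at h

/-- Weighted convolution estimate with gain `θ` (Lemma B.3 type estimate). -/
theorem convolution_weight_gain (N : ℕ) (hN : 5 ≤ N) (a b L0 L1 s : ℝ)
    (ha : 0 < a) (hab : a < b) (hL0 : 0 < L0) (hL01 : L0 < L1) (hs : 0 < s) :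
    ∃ θ C : ℝ, 0 < θ ∧ 0 < C ∧ ∃ k0 : ℕ, 1 ≤ k0 ∧ ∀ k : ℕ, k0 ≤ k →
      ∀ l : ℝ, l ∈ Set.Icc (L0 * (k : ℝ) ^ (((N : ℝ) - 2) / ((N : ℝ) - 4)))
          (L1 * (k : ℝ) ^ (((N : ℝ) - 2) / ((N : ℝ) - 4))) →
      ∀ r : ℝ, r ∈ Set.Icc a b → ∀ y2 : E (N - 2),
      ∀ ξ : E N → ℝ, Measurable ξ → (∀ z, ξ z ∈ Set.Icc (0 : ℝ) 1) →
      ∀ y : E N,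
        (∫ z : E N, ‖y - z‖ ^ (-((N : ℝ) - 2)) *
            (∑ j ∈ Finset.range k, ξ z * (s * bubble N (pt N k r y2 j) l z)) ^ (4 / ((N : ℝ) - 2)) *
            ∑ j ∈ Finset.range k, (1 + l * ‖z - pt N k r y2 j‖) ^ (-(((N : ℝ) - 2) / 2 + tau N)))
          ≤ C * ∑ j ∈ Finset.range k,
              (1 + l * ‖y - pt N k r y2 j‖) ^ (-(((N : ℝ) - 2) / 2 + tau N + θ)) := by
  have h5 : (5 : ℝ) ≤ N := by exact_mod_cast hN
  have ht0 := tau_pos hN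
  have ht1 := tau_lt_one hN
  obtain ⟨C, hC, hconv⟩ := newtonian_convolution_weight_le (N := N) (by omega)
    (β := ((N : ℝ) - 2) / 2 + tau N + 1 / 4) (ε := 1 / 4)
    (by linarith) (by linarith) (by norm_num)
  set M : ℝ := 1 + 4 * ((2 * a) ^ (-tau N) / (L0 ^ tau N * (1 - tau N))) with hM
  have hM0 : 0 < M := by
    have : 0 < 1 - tau N := by linarith
    positivity
  set P : ℝ := (s * ((N : ℝ) * ((N : ℝ) - 2)) ^ (((N : ℝ) - 2) / 4) * M) ^ (4 / ((N : ℝ) - 2)) *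
    4 * M with hP
  have hP0 : 0 < P := by
    have : 0 < (N : ℝ) - 2 := by linarith
    positivity
  refine ⟨1 / 4, P * C, by norm_num, by positivity, 1, le_rfl, ?_⟩
  intro k hk l hl r hr y2 ξ _ hξ y
  have hkpos : (0 : ℝ) < k := by exact_mod_cast hk
  have hl0 : 0 < l := lt_of_lt_of_le (by positivity) hl.1
  set x : ℕ → E N := pt N k r y2 with hx
  set Φ : ℕ → E N → ℝ := fun j z => ‖y - z‖ ^ (-((N : ℝ) - 2)) *
    (l ^ 2 * (1 + l * ‖z - x j‖) ^ (-(2 + (((N : ℝ) - 2) / 2 + tau N + 1 / 4) + 1 / 4))) with hΦ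
  have hΦ0 : ∀ j z, 0 ≤ Φ j z := fun j z => by positivity
  have hpt : ∀ z, ‖y - z‖ ^ (-((N : ℝ) - 2)) *
      (∑ j ∈ Finset.range k, ξ z * (s * bubble N (x j) l z)) ^ (4 / ((N : ℝ) - 2)) *
      ∑ j ∈ Finset.range k, (1 + l * ‖z - x j‖) ^ (-(((N : ℝ) - 2) / 2 + tau N)) ≤
      P * ∑ j ∈ Finset.range k, Φ j z := by
    intro z
    obtain ⟨i, hi, hmin⟩ := Finset.exists_min_image (Finset.range k) (fun j => ‖z - x j‖)
      ⟨0, Finset.mem_range.2 hk⟩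
    have hsum := sum_one_add_rpow_neg_le (by omega) ha hr.1 ht0 ht1 (by positivity) hl0
      (mul_natCast_le_rpow_tau hN hL0 k hl.1) y2 z (Finset.mem_range.1 hi)
      fun j hj => hmin j (Finset.mem_range.2 hj)
    have hloc := potential_mul_weight_le hN hl0 hs x (hξ z) hmin hM0.le hsum
    calc _ ≤ ‖y - z‖ ^ (-((N : ℝ) - 2)) * (P * (l ^ 2 * (1 + l * ‖z - x i‖) ^
          (-(2 + (((N : ℝ) - 2) / 2 + tau N + 1 / 4) + 1 / 4)))) := by
          rw [mul_assoc]
          exact mul_le_mul_of_nonneg_left hloc (by positivity)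
      _ = P * Φ i z := by rw [hΦ]; ring
      _ ≤ _ := mul_le_mul_of_nonneg_left
          (Finset.single_le_sum (f := fun j => Φ j z) (fun j _ => hΦ0 j z) hi) hP0.le
  have hint : ∀ j ∈ Finset.range k, Integrable (Φ j) := fun j _ => (hconv l hl0 (x j) y).1
  calc _ ≤ ∫ z, P * ∑ j ∈ Finset.range k, Φ j z := by
        refine integral_mono_of_nonneg (Filter.Eventually.of_forall fun z => ?_)
          ((integrable_finsetSum _ hint).const_mul P) (Filter.Eventually.of_forall hpt)
        have hW : 0 ≤ ∑ j ∈ Finset.range k, ξ z * (s * bubble N (x j) l z) :=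
          Finset.sum_nonneg fun j _ => mul_nonneg (hξ z).1
            (mul_nonneg hs.le (bubble_nonneg (by omega) _ hl0.le _))
        simp only [Pi.zero_apply]
        positivity
    _ = P * ∑ j ∈ Finset.range k, ∫ z, Φ j z := by
        rw [integral_const_mul, integral_finsetSum _ hint]
    _ ≤ P * ∑ j ∈ Finset.range k,
          C * (1 + l * ‖y - x j‖) ^ (-(((N : ℝ) - 2) / 2 + tau N + 1 / 4)) := by
        gcongr with j _
        exact (hconv l hl0 (x j) y).2
    _ = _ := by rw [← Finset.mul_sum, ← mul_assoc]

end
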